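/- Let ℓ > 0 and α > 0. Then for every integer n ≥ 0 and every real x, the eigenfunctions φ_n of the Gaussian kernel satisfy |φ_n(x)| ≤ K·√β·e^{α²x²/2} with the constant K = 1.087. -/

import Mathlib

/-- Probabilists' Hermite polynomial evaluated at a real number. -/
noncomputable def H (n : ℕ) (x : ℝ) : ℝ := Polynomial.aeval x (Polynomial.hermite n)

open Real Set Filter Topology

lemma antitoneOn_of_hasDerivAt_nonpos {D : Set ℝ} (hD : Convex ℝ D) {f f' : ℝ → ℝ}
    (hf : ∀ x ∈ D, HasDerivAt f (f' x) x) (hf' : ∀ x ∈ D, f' x ≤ 0) : AntitoneOn f D := by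
  refine antitoneOn_of_deriv_nonpos hD (fun x hx => (hf x hx).continuousAt.continuousWithinAt)
    (fun x hx => (hf x (interior_subset hx)).differentiableAt.differentiableWithinAt) ?_
  intro x hx
  rw [(hf x (interior_subset hx)).deriv]
  exact hf' x (interior_subset hx)

/-- The Sonin function of the Liouville transform of a solution of the parabolic cylinder equation
`u'' + (N - y² / 4) u = 0` decreases from `0` to the turning point. -/
lemma sqrt_mul_sq_le_of_parabolicCylinder {u v : ℝ → ℝ} {N : ℝ}
    (hu : ∀ y, HasDerivAt u (v y) y)
    (hv : ∀ y, HasDerivAt v (-(N - y ^ 2 / 4) * u y) y) {y : ℝ} (hy : 0 ≤ y)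
    (hyN : 0 < N - y ^ 2 / 4) :
    √(N - y ^ 2 / 4) * u y ^ 2 ≤ √N * (u 0 ^ 2 + v 0 ^ 2 / N) := by
  let F : ℝ → ℝ := fun t => √(N - t ^ 2 / 4) * (u t ^ 2 +
    (8 * (N - t ^ 2 / 4) * v t - t * u t) ^ 2 /
      (64 * (N - t ^ 2 / 4) ^ 3 + 8 * (N - t ^ 2 / 4) + 5 * t ^ 2))
  let F' : ℝ → ℝ := fun t => -(√(N - t ^ 2 / 4) *
    (8 * (N - t ^ 2 / 4) * v t - t * u t) ^ 2 * t * (18 * (N - t ^ 2 / 4) + 15 / 2 * t ^ 2) /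
    ((N - t ^ 2 / 4) *
      (64 * (N - t ^ 2 / 4) ^ 3 + 8 * (N - t ^ 2 / 4) + 5 * t ^ 2) ^ 2))
  have hq : ∀ t ∈ Icc 0 y, 0 < N - t ^ 2 / 4 := by
    rintro t ⟨h0, h1⟩
    nlinarith
  have hanti : AntitoneOn F (Icc 0 y) := by
    refine antitoneOn_of_hasDerivAt_nonpos (f' := F') (convex_Icc 0 y) ?_ ?_
    · intro t ht
      have hqt := hq t ht
      have hqd : HasDerivAt (fun t : ℝ => N - t ^ 2 / 4) (-(t / 2)) t := by
        have := ((hasDerivAt_pow 2 t).div_const 4).const_sub N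
        refine this.congr_deriv ?_
        push_cast
        ring
      have hP : (64 * (N - t ^ 2 / 4) ^ 3 + 8 * (N - t ^ 2 / 4) + 5 * t ^ 2) ≠ 0 := by
        positivity
      have h1 := (hqd.sqrt hqt.ne').mul (((hu t).pow 2).add
        (((((hqd.const_mul 8).mul (hv t)).sub ((hasDerivAt_id t).mul (hu t))).pow 2).div
          ((((hqd.pow 3).const_mul 64).add (hqd.const_mul 8)).add
            ((hasDerivAt_pow 2 t).const_mul 5)) hP))
      refine h1.congr_deriv ?_
      simp only [F', id, Pi.add_apply, Pi.mul_apply, Pi.sub_apply, Pi.pow_apply, Pi.div_apply]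
      have hsq : √(N - t ^ 2 / 4) ^ 2 = N - t ^ 2 / 4 := Real.sq_sqrt hqt.le
      have hs : 0 < √(N - t ^ 2 / 4) := Real.sqrt_pos.2 hqt
      generalize √(N - t ^ 2 / 4) = s at hsq hs ⊢
      obtain ⟨q, rfl⟩ : ∃ q, N = q + t ^ 2 / 4 := ⟨N - t ^ 2 / 4, by ring⟩
      simp only [add_sub_cancel_right] at *
      have e : -(t / 2) / (2 * s) = s * (-t / (4 * q)) := by
        rw [← hsq]; field_simp; ring
      rw [e]
      push_cast
      field_simp
      ring
    · intro t ht
      have hqt := hq t ht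
      have h0 := ht.1
      simp only [F']
      rw [neg_nonpos]
      positivity
  have h := hanti ⟨le_rfl, hy⟩ ⟨hy, le_rfl⟩ hy
  have hN : 0 < N := by nlinarith [sq_nonneg y]
  calc √(N - y ^ 2 / 4) * u y ^ 2 ≤ F y := by
        simp only [F]
        gcongr
        have : 0 ≤ (8 * (N - y ^ 2 / 4) * v y - y * u y) ^ 2 /
          (64 * (N - y ^ 2 / 4) ^ 3 + 8 * (N - y ^ 2 / 4) + 5 * y ^ 2) := by positivity
        linarith
    _ ≤ F 0 := h
    _ ≤ √N * (u 0 ^ 2 + v 0 ^ 2 / N) := by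
        simp only [F]
        norm_num
        refine mul_le_mul_of_nonneg_left (add_le_add_right ?_ _) (Real.sqrt_nonneg N)
        rw [div_le_div_iff₀ (by positivity) hN]
        nlinarith [mul_nonneg hN.le (sq_nonneg (v 0))]

/-- If `R ≥ 0` is a supersolution of the Riccati equation `R' = R² + q` on `[a, ∞)`, a solution of
`u'' + q u = 0` for which `u (u' + R u)` does not stay positive at infinity has `u²` decreasing. -/
lemma antitoneOn_sq_of_riccati {u v q R R' : ℝ → ℝ} {a : ℝ}
    (hu : ∀ y, HasDerivAt u (v y) y) (hv : ∀ y, HasDerivAt v (-q y * u y) y)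
    (hR : ∀ y ∈ Ici a, HasDerivAt R (R' y) y) (hR0 : ∀ y ∈ Ici a, 0 ≤ R y)
    (hRic : ∀ y ∈ Ici a, R y ^ 2 + q y ≤ R' y)
    (hlim : Tendsto (fun y => u y * (v y + R y * u y)) atTop (𝓝 0)) :
    AntitoneOn (fun y => u y ^ 2) (Ici a) := by
  have hanti : AntitoneOn (fun y => -(u y * (v y + R y * u y))) (Ici a) := by
    refine antitoneOn_of_hasDerivAt_nonpos (convex_Ici a)
      (fun y hy => ((hu y).mul ((hv y).add ((hR y hy).mul (hu y)))).neg) ?_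
    intro y hy
    simp only [Pi.add_apply, Pi.mul_apply]
    nlinarith [sq_nonneg (v y + R y * u y),
      mul_nonneg (sub_nonneg.2 (hRic y hy)) (sq_nonneg (u y))]
  have hW : ∀ y ∈ Ici a, u y * (v y + R y * u y) ≤ 0 := by
    intro y hy
    refine ge_of_tendsto hlim ?_
    filter_upwards [eventually_ge_atTop y] with z hz
    have := hanti hy (mem_Ici.2 (le_trans hy hz)) hz
    simpa using this
  refine antitoneOn_of_hasDerivAt_nonpos (convex_Ici a) (fun y _ => (hu y).pow 2) ?_
  intro y hy
  have := hW y hy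
  have := mul_nonneg (hR0 y hy) (sq_nonneg (u y))
  norm_num
  nlinarith

lemma derivative_hermite_succ (n : ℕ) :
    Polynomial.derivative (Polynomial.hermite (n + 1)) =
      ((n : Polynomial ℤ) + 1) * Polynomial.hermite n := by
  induction n with
  | zero => simp
  | succ n ih =>
    rw [Polynomial.hermite_succ (n + 1), Polynomial.derivative_sub, Polynomial.derivative_mul, ih,
      Polynomial.derivative_X, Polynomial.derivative_mul, Polynomial.hermite_succ n]
    simp
    ring

lemma H_zero (x : ℝ) : H 0 x = 1 := by simp [H]

lemma H_one (x : ℝ) : H 1 x = x := by simp [H]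

lemma H_add_two (n : ℕ) (x : ℝ) : H (n + 2) x = x * H (n + 1) x - (n + 1) * H n x := by
  rw [H, Polynomial.hermite_succ (n + 1), derivative_hermite_succ]
  simp [H]

lemma hasDerivAt_H_succ (n : ℕ) (x : ℝ) : HasDerivAt (H (n + 1)) ((n + 1) * H n x) x := by
  have := (Polynomial.hermite (n + 1)).hasDerivAt_aeval x
  rw [derivative_hermite_succ] at this
  exact this.congr_deriv (by simp [H])

lemma hasDerivAt_H (n : ℕ) (x : ℝ) : HasDerivAt (H n) (x * H n x - H (n + 1) x) x := by
  have := (Polynomial.hermite n).hasDerivAt_aeval x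
  exact this.congr_deriv (by simp [H, Polynomial.hermite_succ])

lemma H_neg (n : ℕ) (x : ℝ) : H n (-x) = (-1) ^ n * H n x := by
  induction n using Nat.twoStepInduction with
  | zero => simp [H_zero]
  | one => simp [H_one]
  | more n ih1 ih2 =>
    rw [H_add_two, H_add_two, ih1, ih2]
    ring

lemma H_odd_zero (m : ℕ) : H (2 * m + 1) 0 = 0 := by
  have := H_neg (2 * m + 1) 0
  simp [pow_succ, pow_mul] at this
  linarith

lemma sq_H_even_zero_le (m : ℕ) :
    (H (2 * m) 0 ^ 2) ^ 2 * (2 * m + 1) ≤ ((2 * m).factorial : ℝ) ^ 2 := by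
  induction m with
  | zero => simp [H_zero]
  | succ m ih =>
    have h : H (2 * (m + 1)) 0 = -(2 * m + 1) * H (2 * m) 0 := by
      rw [show 2 * (m + 1) = 2 * m + 2 by ring, H_add_two]
      push_cast
      ring
    rw [h, show 2 * (m + 1) = (2 * m + 1) + 1 by ring, Nat.factorial_succ, Nat.factorial_succ]
    push_cast
    have hm : (0 : ℝ) ≤ m := m.cast_nonneg
    calc ((-(2 * (m : ℝ) + 1) * H (2 * m) 0) ^ 2) ^ 2 * (2 * (m + 1) + 1)
        = (2 * (m : ℝ) + 1) ^ 2 * ((2 * m + 1) * (2 * m + 3)) *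
          ((H (2 * m) 0 ^ 2) ^ 2 * (2 * m + 1)) := by ring
      _ ≤ (2 * (m : ℝ) + 1) ^ 2 * (2 * m + 2) ^ 2 * ((2 * m).factorial : ℝ) ^ 2 := by
        gcongr
        nlinarith
      _ = _ := by ring

/-- The unnormalised Hermite function `y ↦ H n y * exp (-y² / 4)`. -/
noncomputable def hermiteFun (n : ℕ) (y : ℝ) : ℝ := H n y * exp (-y ^ 2 / 4)

lemma hasDerivAt_exp_neg_sq_div_four (y : ℝ) :
    HasDerivAt (fun y : ℝ => exp (-y ^ 2 / 4)) (exp (-y ^ 2 / 4) * (-(y / 2))) y := by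
  have := (((hasDerivAt_pow 2 y).neg).div_const 4).exp
  refine this.congr_deriv ?_
  simp
  ring

lemma hasDerivAt_hermiteFun_succ (n : ℕ) (y : ℝ) :
    HasDerivAt (hermiteFun (n + 1))
      ((n + 1) * hermiteFun n y - y / 2 * hermiteFun (n + 1) y) y := by
  refine ((hasDerivAt_H_succ n y).mul (hasDerivAt_exp_neg_sq_div_four y)).congr_deriv ?_
  simp only [hermiteFun]
  ring

lemma hasDerivAt_hermiteFun (n : ℕ) (y : ℝ) :
    HasDerivAt (hermiteFun n) (y / 2 * hermiteFun n y - hermiteFun (n + 1) y) y := by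
  refine ((hasDerivAt_H n y).mul (hasDerivAt_exp_neg_sq_div_four y)).congr_deriv ?_
  simp only [hermiteFun]
  ring

lemma hasDerivAt_deriv_hermiteFun_succ (n : ℕ) (y : ℝ) :
    HasDerivAt (fun y => (n + 1) * hermiteFun n y - y / 2 * hermiteFun (n + 1) y)
      (-((n : ℝ) + 3 / 2 - y ^ 2 / 4) * hermiteFun (n + 1) y) y := by
  refine (((hasDerivAt_hermiteFun n y).const_mul ((n : ℝ) + 1)).sub
    (((hasDerivAt_id y).div_const 2).mul (hasDerivAt_hermiteFun_succ n y))).congr_deriv ?_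
  simp only [id]
  ring

lemma sqrt_mul_hermiteFun_initial_le (n : ℕ) :
    √((n : ℝ) + 3 / 2) * (hermiteFun (n + 1) 0 ^ 2 +
      ((n + 1) * hermiteFun n 0 - 0 / 2 * hermiteFun (n + 1) 0) ^ 2 / ((n : ℝ) + 3 / 2)) ≤
      ((n + 1).factorial : ℝ) := by
  simp only [hermiteFun]
  refine le_of_sq_le_sq ?_ (by positivity)
  rw [mul_pow, Real.sq_sqrt (by positivity)]
  rcases Nat.even_or_odd' n with ⟨m, rfl | rfl⟩
  · rw [H_odd_zero, Nat.factorial_succ]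
    have := sq_H_even_zero_le m
    push_cast
    norm_num
    have hm : (0 : ℝ) ≤ m := m.cast_nonneg
    rw [div_pow, ← mul_div_assoc, div_le_iff₀ (by positivity)]
    calc (2 * (m : ℝ) + 3 / 2) * (((2 * m + 1) * H (2 * m) 0) ^ 2) ^ 2
        = (2 * (m : ℝ) + 3 / 2) * (2 * m + 1) ^ 3 * ((H (2 * m) 0 ^ 2) ^ 2 * (2 * m + 1)) := by
          ring
      _ ≤ (2 * (m : ℝ) + 3 / 2) * ((2 * m + 1) ^ 2 * (2 * m + 3 / 2)) *
          ((2 * m).factorial : ℝ) ^ 2 := by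
          gcongr
          rw [pow_succ]
          gcongr
          norm_num
      _ = _ := by ring
  · rw [H_odd_zero]
    have := sq_H_even_zero_le (m + 1)
    rw [show 2 * m + 1 + 1 = 2 * (m + 1) by ring]
    push_cast at this ⊢
    norm_num
    refine le_trans (le_trans ?_ this) (by norm_num)
    rw [mul_comm]
    exact mul_le_mul_of_nonneg_left (by linarith) (by positivity)

lemma tendsto_eval_mul_exp_neg_sq (p : Polynomial ℝ) :
    Tendsto (fun y : ℝ => p.eval y * exp (-y ^ 2 / 2)) atTop (𝓝 0) := by
  refine squeeze_zero_norm' ?_ (by simpa only [norm_zero] using p.tendsto_div_exp_atTop.norm)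
  filter_upwards [eventually_ge_atTop 2] with y hy
  rw [div_eq_mul_inv (p.eval y), ← exp_neg]
  simp only [norm_mul, Real.norm_eq_abs, abs_exp]
  gcongr
  nlinarith

lemma antitoneOn_sq_hermiteFun_succ (n : ℕ) :
    AntitoneOn (fun y => hermiteFun (n + 1) y ^ 2) (Ici √(4 * n + 2)) := by
  have hsq : ∀ y ∈ Ici √(4 * (n : ℝ) + 2), 0 < y ∧ 4 * (n : ℝ) + 2 ≤ y ^ 2 := by
    intro y hy
    have h0 : 0 < √(4 * (n : ℝ) + 2) := Real.sqrt_pos.2 (by positivity)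
    exact ⟨h0.trans_le hy, (Real.sqrt_le_left (h0.le.trans hy)).1 hy⟩
  refine antitoneOn_sq_of_riccati (q := fun y => (n : ℝ) + 3 / 2 - y ^ 2 / 4)
    (R := fun y => y / 2 - (2 * n + 1) / y) (R' := fun y => 1 / 2 + (2 * n + 1) / y ^ 2)
    (hasDerivAt_hermiteFun_succ n) (hasDerivAt_deriv_hermiteFun_succ n) ?_ ?_ ?_ ?_
  · intro y hy
    have hy0 := (hsq y hy).1
    refine (((hasDerivAt_id y).div_const 2).sub
      ((hasDerivAt_const y (2 * (n : ℝ) + 1)).div (hasDerivAt_id y) hy0.ne')).congr_deriv ?_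
    simp only [id]
    ring
  · intro y hy
    obtain ⟨hy0, hy2⟩ := hsq y hy
    rw [sub_nonneg, div_le_iff₀ hy0]
    nlinarith
  · intro y hy
    obtain ⟨hy0, hy2⟩ := hsq y hy
    have e : (1 / 2 + (2 * n + 1) / y ^ 2) - ((y / 2 - (2 * n + 1) / y) ^ 2 +
        ((n : ℝ) + 3 / 2 - y ^ 2 / 4)) = n * (y ^ 2 - (4 * n + 2)) / y ^ 2 := by
      field_simp
      ring
    have : 0 ≤ n * (y ^ 2 - (4 * n + 2)) / y ^ 2 := by
      have := sub_nonneg.2 hy2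
      positivity
    linarith
  · let p : ℕ → Polynomial ℝ := fun k => (Polynomial.hermite k).map (Int.castRingHom ℝ)
    have hp : ∀ k y, (p k).eval y = H k y := by
      intro k y
      simp [p, H, Polynomial.aeval_def, Polynomial.eval_map]
    have h1 := (tendsto_eval_mul_exp_neg_sq
      (Polynomial.C ((n : ℝ) + 1) * p n * p (n + 1))).sub
      ((tendsto_eval_mul_exp_neg_sq (Polynomial.C (2 * (n : ℝ) + 1) * p (n + 1) ^ 2)).mul
        tendsto_inv_atTop_zero)
    simp only [mul_zero, sub_zero] at h1
    refine h1.congr ?_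
    intro y
    have he : exp (-y ^ 2 / 2) = exp (-y ^ 2 / 4) ^ 2 := by
      rw [← exp_nat_mul]
      congr 1
      push_cast
      ring
    simp only [Polynomial.eval_mul, Polynomial.eval_pow, Polynomial.eval_C, hp, he, hermiteFun]
    ring

lemma sq_hermiteFun_succ_le_of_sq_le (n : ℕ) {y : ℝ} (hy : 0 ≤ y) (hyn : y ^ 2 ≤ 4 * n + 2) :
    hermiteFun (n + 1) y ^ 2 ≤ ((n + 1).factorial : ℝ) := by
  have hq : 1 ≤ (n : ℝ) + 3 / 2 - y ^ 2 / 4 := by linarith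
  have h := sqrt_mul_sq_le_of_parabolicCylinder (hasDerivAt_hermiteFun_succ n)
    (hasDerivAt_deriv_hermiteFun_succ n) hy (by linarith)
  refine le_trans ?_ (h.trans (sqrt_mul_hermiteFun_initial_le n))
  exact le_mul_of_one_le_left (sq_nonneg _) (Real.one_le_sqrt.2 hq)

/-- Cramér's inequality for the Hermite functions, with the optimal constant `1`. -/
theorem sq_hermiteFun_le (n : ℕ) (y : ℝ) : hermiteFun n y ^ 2 ≤ (n.factorial : ℝ) := by
  wlog hy : 0 ≤ y generalizing y
  · have := this (-y) (by linarith)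
    simpa [hermiteFun, H_neg, mul_pow, ← pow_mul, mul_comm n 2] using this
  cases n with
  | zero =>
    have : exp (-y ^ 2 / 4) ≤ 1 := exp_le_one_iff.2 (by nlinarith [sq_nonneg y])
    simpa [hermiteFun, H_zero] using pow_le_one₀ (n := 2) (exp_pos _).le this
  | succ n =>
    rcases le_total (y ^ 2) (4 * n + 2) with h | h
    · exact sq_hermiteFun_succ_le_of_sq_le n hy h
    · have h1 : √(4 * (n : ℝ) + 2) ≤ y := (Real.sqrt_le_left hy).2 h
      refine (antitoneOn_sq_hermiteFun_succ n self_mem_Ici h1 h1).trans ?_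
      exact sq_hermiteFun_succ_le_of_sq_le n (Real.sqrt_nonneg _)
        (Real.sq_sqrt (by positivity)).le

theorem stmt_6 (ℓ α : ℝ) (hℓ : 0 < ℓ) (hα : 0 < α)
    (ε β δ2 : ℝ)
    (hε : ε = 1 / (Real.sqrt 2 * ℓ))
    (hβ : β = (1 + (2 * ε / α) ^ 2) ^ ((1 : ℝ) / 4))
    (hδ2 : δ2 = α ^ 2 * (β ^ 2 - 1) / 2)
    (φ : ℕ → ℝ → ℝ)
    (hφ : ∀ n x, φ n x = Real.sqrt (β / (n.factorial : ℝ)) * Real.exp (-δ2 * x ^ 2) *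
      H n (Real.sqrt 2 * α * β * x))
    (n : ℕ) (x : ℝ) :
    |φ n x| ≤ 1.087 * Real.sqrt β * Real.exp (α ^ 2 * x ^ 2 / 2) := by
  have hβ0 : 0 ≤ β := by rw [hβ]; positivity
  have hn : 0 < √(n.factorial : ℝ) := Real.sqrt_pos.2 (by positivity)
  set y := √2 * α * β * x with hy
  have hy2 : y ^ 2 = 2 * α ^ 2 * β ^ 2 * x ^ 2 := by
    rw [hy, mul_pow, mul_pow, mul_pow, Real.sq_sqrt (by norm_num)]
  have hexp : exp (-δ2 * x ^ 2) = exp (α ^ 2 * x ^ 2 / 2) * exp (-y ^ 2 / 4) := by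
    rw [← exp_add, hy2, hδ2]
    congr 1
    ring
  have hφn : φ n x = √β * exp (α ^ 2 * x ^ 2 / 2) * (hermiteFun n y / √(n.factorial : ℝ)) := by
    rw [hφ, hexp, Real.sqrt_div hβ0, hermiteFun]
    ring
  have hbound : |hermiteFun n y / √(n.factorial : ℝ)| ≤ 1 := by
    rw [abs_div, abs_of_pos hn, div_le_one hn]
    exact Real.abs_le_sqrt (sq_hermiteFun_le n y)
  rw [hφn, abs_mul, abs_of_nonneg (by positivity)]
  calc √β * exp (α ^ 2 * x ^ 2 / 2) * |hermiteFun n y / √(n.factorial : ℝ)|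
      ≤ √β * exp (α ^ 2 * x ^ 2 / 2) * 1.087 := by
        gcongr
        exact hbound.trans (by norm_num)
    _ = _ := by ring
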